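/- The number of partitions of n into distinct parts not congruent to 2 mod 4 equals the number of partitions of n in which the odd parts are distinct and every even part is congruent to 2 mod 4 and occurs with even multiplicity. -/

import Mathlib

/-- `Q2 n`: number of partitions of `n` into distinct parts none ≡ 2 (mod 4). -/
noncomputable def Q2 (n : ℕ) : ℕ :=
  Nat.card {p : n.Partition // p.parts.Nodup ∧ ∀ x ∈ p.parts, x % 4 ≠ 2}

namespace Stmt17

/-- Multisets of positive distinct numbers. -/
abbrev Dt := {t : Multiset ℕ // t.Nodup ∧ ∀ x ∈ t, 0 < x}

/-- Multisets of odd numbers. -/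
abbrev Ot := {t : Multiset ℕ // ∀ x ∈ t, ¬ Even x}

def dFiber (m : ℕ) : {a : Dt // a.1.sum = m} ≃ Nat.Partition.distincts m where
  toFun a := ⟨⟨a.1.1, fun {i} hi => a.1.2.2 i hi, a.2⟩, by
    simpa [Nat.Partition.distincts] using a.1.2.1⟩
  invFun p := ⟨⟨p.1.parts, by
    simpa [Nat.Partition.distincts] using p.2, fun x hx => p.1.parts_pos hx⟩, p.1.parts_sum⟩
  left_inv a := rfl
  right_inv p := rfl

def oFiber (m : ℕ) : {a : Ot // a.1.sum = m} ≃ Nat.Partition.odds m where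
  toFun a := ⟨⟨a.1.1, fun {i} hi => by
    have := a.1.2 i hi
    rcases Nat.eq_zero_or_pos i with h | h
    · subst h; simp at this
    · exact h, a.2⟩, by
    simpa [Nat.Partition.odds, Nat.Partition.restricted] using a.1.2⟩
  invFun p := ⟨⟨p.1.parts, by
    simpa [Nat.Partition.odds, Nat.Partition.restricted] using p.2⟩, p.1.parts_sum⟩
  left_inv a := rfl
  right_inv p := rfl

theorem exists_equiv : ∃ e : Dt ≃ Ot, ∀ t, (e t).1.sum = t.1.sum := by
  let E : ∀ m, {a : Dt // a.1.sum = m} ≃ {a : Ot // a.1.sum = m} := fun m =>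
    (dFiber m).trans ((Finset.equivOfCardEq
      (Nat.Partition.card_odds_eq_card_distincts m).symm).trans (oFiber m).symm)
  exact ⟨Equiv.ofFiberEquiv E, fun t => Equiv.ofFiberEquiv_map E t⟩

theorem exists_half (t : Multiset ℕ) (h : ∀ x, Even (t.count x)) : ∃ u, t = u + u := by
  refine ⟨Finsupp.toMultiset (t.toFinsupp.mapRange (· / 2) rfl), ?_⟩
  ext x
  obtain ⟨k, hk⟩ := h x
  simp [Finsupp.count_toMultiset, hk]
  omega

/-- Odd distinct part together with a multiset, of total weight `n`. -/
abbrev TD (n : ℕ) := {x : Multiset ℕ × Dt //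
  (x.1.Nodup ∧ ∀ i ∈ x.1, Odd i) ∧ x.1.sum + 4 * x.2.1.sum = n}

abbrev TO (n : ℕ) := {x : Multiset ℕ × Ot //
  (x.1.Nodup ∧ ∀ i ∈ x.1, Odd i) ∧ x.1.sum + 4 * x.2.1.sum = n}

theorem card_TD_TO (n : ℕ) : Nat.card (TD n) = Nat.card (TO n) := by
  obtain ⟨e, he⟩ := exists_equiv
  refine Nat.card_congr (((Equiv.refl _).prodCongr e).subtypeEquiv ?_)
  intro a
  simp [he]

theorem filter_odd_add (s t : Multiset ℕ) (hs : ∀ i ∈ s, Odd i) (ht : ∀ i ∈ t, ¬ Odd i) :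
    (s + t).filter (fun i => Odd i) = s := by
  rw [Multiset.filter_add, Multiset.filter_eq_self.2 hs, Multiset.filter_eq_nil.2 ht, add_zero]

theorem split_inj {s t s' t' : Multiset ℕ} (hs : ∀ i ∈ s, Odd i) (ht : ∀ i ∈ t, ¬ Odd i)
    (hs' : ∀ i ∈ s', Odd i) (ht' : ∀ i ∈ t', ¬ Odd i) (h : s + t = s' + t') :
    s = s' ∧ t = t' := by
  have h1 : s = s' := by
    rw [← filter_odd_add s t hs ht, h, filter_odd_add s' t' hs' ht']
  subst h1
  exact ⟨rfl, by simpa using h⟩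

theorem four_even (t : Multiset ℕ) : ∀ i ∈ t.map (4 * ·), ¬ Odd i := by
  intro i hi
  obtain ⟨j, _, rfl⟩ := Multiset.mem_map.1 hi
  rw [Nat.not_odd_iff_even]; exact ⟨2 * j, by ring⟩

theorem two_even (t : Multiset ℕ) : ∀ i ∈ t.map (2 * ·) + t.map (2 * ·), ¬ Odd i := by
  intro i hi
  have hi : i ∈ t.map (2 * ·) := by simpa using hi
  obtain ⟨j, _, rfl⟩ := Multiset.mem_map.1 hi
  rw [Nat.not_odd_iff_even]; exact ⟨j, by ring⟩

theorem card_left (n : ℕ) : Nat.card (TD n) = Q2 n := by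
  unfold Q2
  refine Nat.card_eq_of_bijective
    (fun x : TD n => (⟨⟨x.1.1 + x.1.2.1.map (4 * ·), ?_, ?_⟩, ?_, ?_⟩ :
      {p : n.Partition // p.parts.Nodup ∧ ∀ x ∈ p.parts, x % 4 ≠ 2})) ⟨?_, ?_⟩
  · intro i hi
    rcases Multiset.mem_add.1 hi with h | h
    · exact (x.2.1.2 i h).pos
    · obtain ⟨j, hj, rfl⟩ := Multiset.mem_map.1 h
      have := x.1.2.2.2 j hj
      omega
  · rw [Multiset.sum_add, Multiset.sum_map_mul_left, Multiset.map_id']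
    exact x.2.2
  · refine Multiset.nodup_add.2 ⟨x.2.1.1, ?_, ?_⟩
    · exact x.1.2.2.1.map (fun a b h => by simpa using h)
    · rw [Multiset.disjoint_left]
      intro i hi hi'
      exact four_even _ i hi' (x.2.1.2 i hi)
  · intro i hi
    rcases Multiset.mem_add.1 hi with h | h
    · have := Nat.odd_iff.1 (x.2.1.2 i h)
      omega
    · obtain ⟨j, hj, rfl⟩ := Multiset.mem_map.1 h
      omega
  · rintro ⟨⟨s, t⟩, h⟩ ⟨⟨s', t'⟩, h'⟩ hh
    have hh : s + t.1.map (4 * ·) = s' + t'.1.map (4 * ·) :=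
      congrArg (fun q => q.1.parts) hh
    obtain ⟨h1, h2⟩ := split_inj h.1.2 (four_even _) h'.1.2 (four_even _) hh
    have h3 := Multiset.map_injective (fun a b h => by simpa using h) h2
    subst h1
    have h4 : t = t' := Subtype.ext h3
    subst h4
    rfl
  · rintro ⟨p, hp, hp4⟩
    have key : p.parts.filter (fun i => Odd i) +
        ((p.parts.filter (fun i => ¬ Odd i)).map (· / 4)).map (4 * ·) = p.parts := by
      conv_rhs => rw [← Multiset.filter_add_not (fun i => Odd i) p.parts]
      congr 1
      rw [Multiset.map_map]
      conv_rhs => rw [← Multiset.map_id' (p.parts.filter (fun i => ¬ Odd i))]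
      refine Multiset.map_congr rfl ?_
      intro i hi
      obtain ⟨hi, hi'⟩ := Multiset.mem_filter.1 hi
      have := hp4 i hi
      rw [Nat.odd_iff] at hi'
      simp only [Function.comp]
      omega
    have hnd : (p.parts.filter (fun i => ¬ Odd i)).map (· / 4) |>.Nodup := by
      refine Multiset.Nodup.of_map (4 * ·) ?_
      refine Multiset.nodup_of_le ?_ hp
      exact (Multiset.le_add_left _ _).trans key.le
    refine ⟨⟨⟨p.parts.filter (fun i => Odd i),
      ⟨(p.parts.filter (fun i => ¬ Odd i)).map (· / 4), hnd, ?_⟩⟩, ⟨?_, ?_⟩, ?_⟩, ?_⟩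
    · intro x hx
      obtain ⟨i, hi, rfl⟩ := Multiset.mem_map.1 hx
      obtain ⟨hi, hi'⟩ := Multiset.mem_filter.1 hi
      have := hp4 i hi
      have := p.parts_pos hi
      rw [Nat.odd_iff] at hi'
      omega
    · exact hp.filter _
    · intro i hi
      exact (Multiset.mem_filter.1 hi).2
    · have := congrArg Multiset.sum key
      rw [Multiset.sum_add, Multiset.sum_map_mul_left, Multiset.map_id', p.parts_sum] at this
      exact this
    · apply Subtype.ext
      apply Nat.Partition.ext
      exact key

theorem card_right (n : ℕ) : Nat.card (TO n) = Nat.card {p : n.Partition //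
        (∀ x, Odd x → p.parts.count x ≤ 1) ∧
          ∀ x ∈ p.parts, Even x → x % 4 = 2 ∧ Even (p.parts.count x)} := by
  refine Nat.card_eq_of_bijective
    (fun x : TO n => (⟨⟨x.1.1 + (x.1.2.1.map (2 * ·) + x.1.2.1.map (2 * ·)), ?_, ?_⟩, ?_, ?_⟩ :
      {p : n.Partition // (∀ x, Odd x → p.parts.count x ≤ 1) ∧
          ∀ x ∈ p.parts, Even x → x % 4 = 2 ∧ Even (p.parts.count x)})) ⟨?_, ?_⟩
  · intro i hi
    rcases Multiset.mem_add.1 hi with h | h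
    · exact (x.2.1.2 i h).pos
    · have h : i ∈ x.1.2.1.map (2 * ·) := by simpa using h
      obtain ⟨j, hj, rfl⟩ := Multiset.mem_map.1 h
      have := x.1.2.2 j hj
      rw [Nat.even_iff] at this
      omega
  · have := x.2.2
    rw [Multiset.sum_add, Multiset.sum_add, Multiset.sum_map_mul_left, Multiset.map_id']
    omega
  · intro i hi
    have h1 := Multiset.nodup_iff_count_le_one.1 x.2.1.1 i
    have h2 := Multiset.count_eq_zero.2 (fun h => two_even x.1.2.1 i h hi)
    simp only [Multiset.count_add] at h2 ⊢
    omega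
  · intro i hi hev
    have hns : i ∉ x.1.1 := fun h => Nat.not_odd_iff_even.2 hev (x.2.1.2 i h)
    constructor
    · rcases Multiset.mem_add.1 hi with h | h
      · exact absurd h hns
      · have h : i ∈ x.1.2.1.map (2 * ·) := by simpa using h
        obtain ⟨j, hj, rfl⟩ := Multiset.mem_map.1 h
        have := x.1.2.2 j hj
        rw [Nat.even_iff] at this
        omega
    · simp only [Multiset.count_add]
      rw [Multiset.count_eq_zero.2 hns, zero_add]
      exact ⟨_, rfl⟩
  · rintro ⟨⟨s, t⟩, h⟩ ⟨⟨s', t'⟩, h'⟩ hh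
    have hh : s + (t.1.map (2 * ·) + t.1.map (2 * ·)) =
        s' + (t'.1.map (2 * ·) + t'.1.map (2 * ·)) :=
      congrArg (fun q => q.1.parts) hh
    obtain ⟨h1, h2⟩ := split_inj h.1.2 (two_even _) h'.1.2 (two_even _) hh
    have h2' : t.1.map (2 * ·) = t'.1.map (2 * ·) := by
      ext i
      have := congrArg (Multiset.count i) h2
      simp only [Multiset.count_add] at this
      omega
    have h3 := Multiset.map_injective (fun a b h => by simpa using h) h2'
    subst h1
    have h4 : t = t' := Subtype.ext h3
    subst h4
    rfl
  · rintro ⟨p, hp, hp4⟩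
    obtain ⟨u, hu⟩ := exists_half (p.parts.filter (fun i => ¬ Odd i)) (by
      intro x
      rw [Multiset.count_filter]
      by_cases hx : Odd x
      · rw [if_neg (not_not.2 hx)]; exact ⟨0, rfl⟩
      · rw [if_pos hx]
        by_cases hm : x ∈ p.parts
        · exact (hp4 x hm (Nat.not_odd_iff_even.1 hx)).2
        · rw [Multiset.count_eq_zero.2 hm]; exact ⟨0, rfl⟩)
    have hu4 : ∀ i ∈ u, i % 4 = 2 := by
      intro i hi
      have hi : i ∈ p.parts.filter (fun i => ¬ Odd i) := by
        rw [hu]; exact Multiset.mem_add.2 (Or.inl hi)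
      obtain ⟨hi, hi'⟩ := Multiset.mem_filter.1 hi
      exact (hp4 i hi (Nat.not_odd_iff_even.1 hi')).1
    have hu2 : (u.map (· / 2)).map (2 * ·) = u := by
      rw [Multiset.map_map]
      conv_rhs => rw [← Multiset.map_id' u]
      refine Multiset.map_congr rfl ?_
      intro i hi
      have := hu4 i hi
      simp only [Function.comp]
      omega
    have key : p.parts.filter (fun i => Odd i) +
        ((u.map (· / 2)).map (2 * ·) + (u.map (· / 2)).map (2 * ·)) = p.parts := by
      rw [hu2, ← hu]
      exact Multiset.filter_add_not (fun i => Odd i) p.parts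
    refine ⟨⟨⟨p.parts.filter (fun i => Odd i),
      ⟨u.map (· / 2), ?_⟩⟩, ⟨?_, ?_⟩, ?_⟩, ?_⟩
    · intro x hx
      obtain ⟨i, hi, rfl⟩ := Multiset.mem_map.1 hx
      have := hu4 i hi
      rw [Nat.even_iff]
      omega
    · rw [Multiset.nodup_iff_count_le_one]
      intro i
      rw [Multiset.count_filter]
      split_ifs with hx
      · exact hp i hx
      · exact Nat.zero_le _
    · intro i hi
      exact (Multiset.mem_filter.1 hi).2
    · have := congrArg Multiset.sum key
      rw [Multiset.sum_add, Multiset.sum_add, Multiset.sum_map_mul_left, Multiset.map_id',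
        p.parts_sum] at this
      simp only
      omega
    · apply Subtype.ext
      apply Nat.Partition.ext
      exact key

end Stmt17

/-- `Q2 n` equals the number of partitions of `n` whose odd parts are distinct and whose
even parts are all ≡ 2 (mod 4) and occur with even multiplicity. -/
theorem stmt_17 (n : ℕ) :
    Q2 n =
      Nat.card {p : n.Partition //
        (∀ x, Odd x → p.parts.count x ≤ 1) ∧
          ∀ x ∈ p.parts, Even x → x % 4 = 2 ∧ Even (p.parts.count x)} := by
  rw [← Stmt17.card_left, Stmt17.card_TD_TO, Stmt17.card_right]
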